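/- Let 𝒱 be a finite set of conjunctive-query views. Every q-hierarchical conjunctive query that has some 𝒱-rewriting also has a q-hierarchical 𝒱-rewriting. -/

import Mathlib

/-- A relational atom (or fact): a relation symbol with a list of arguments.
Arguments are natural numbers, serving both as variables and as data values. -/
structure Atom where
  rel : ℕ
  args : List ℕ
deriving DecidableEq

/-- Apply a substitution to an atom. -/
def mapAtom (f : ℕ → ℕ) (A : Atom) : Atom := ⟨A.rel, A.args.map f⟩

/-- The variables of an atom. -/
def Atom.vars (A : Atom) : Finset ℕ := A.args.toFinset

/-- The variables of a finite set of atoms. -/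
def varsOf (B : Finset Atom) : Finset ℕ := B.biUnion Atom.vars

/-- A conjunctive query: a head atom and a finite set of body atoms. -/
structure CQ where
  head : Atom
  body : Finset Atom
deriving DecidableEq

/-- All variables of a conjunctive query. -/
def CQ.vars (Q : CQ) : Finset ℕ := Q.head.vars ∪ varsOf Q.body

/-- A schema: a set of relation symbols together with an arity function. -/
structure Schema where
  rels : Set ℕ
  ar : ℕ → ℕ

/-- An atom (or fact) over a schema. -/
def atomOver (σ : Schema) (A : Atom) : Prop :=
  A.rel ∈ σ.rels ∧ A.args.length = σ.ar A.rel

/-- `Q` is a (well-formed) conjunctive query over schema `σ`: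
nonempty body of σ-atoms, head relation symbol not in σ, and safety. -/
def isCQ (σ : Schema) (Q : CQ) : Prop :=
  Q.body.Nonempty ∧ (∀ A ∈ Q.body, atomOver σ A) ∧
  Q.head.rel ∉ σ.rels ∧ Q.head.vars ⊆ varsOf Q.body

/-- A database is a set of facts (finiteness is imposed where needed). -/
abbrev Database := Set Atom

/-- A database over a schema. -/
def isDBOver (σ : Schema) (D : Database) : Prop := ∀ F ∈ D, atomOver σ F

/-- The result of a conjunctive query on a database. -/
def evalCQ (Q : CQ) (D : Database) : Set Atom :=
  { F | ∃ ν : ℕ → ℕ, (∀ A ∈ Q.body, mapAtom ν A ∈ D) ∧ mapAtom ν Q.head = F }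

/-- Containment of conjunctive queries. -/
def containedCQ (Q1 Q2 : CQ) : Prop :=
  ∀ D : Database, D.Finite → evalCQ Q1 D ⊆ evalCQ Q2 D

/-- Equivalence of conjunctive queries. -/
def equivCQ (Q1 Q2 : CQ) : Prop :=
  ∀ D : Database, D.Finite → evalCQ Q1 D = evalCQ Q2 D

/-- A conjunctive query is minimal if no equivalent CQ has strictly fewer body atoms. -/
def isMinimal (Q : CQ) : Prop :=
  ∀ Q2 : CQ, equivCQ Q Q2 → Q.body.card ≤ Q2.body.card

/-- A homomorphism from `Q2` to `Q1`. -/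
def isHom (h : ℕ → ℕ) (Q2 Q1 : CQ) : Prop :=
  (∀ A ∈ Q2.body, mapAtom h A ∈ Q1.body) ∧ mapAtom h Q2.head = Q1.head

/-- A body homomorphism from `Q2` to `Q1`. -/
def isBodyHom (h : ℕ → ℕ) (Q2 Q1 : CQ) : Prop :=
  ∀ A ∈ Q2.body, mapAtom h A ∈ Q1.body

/-- A set of views over σ: each view is a CQ over σ and views have
pairwise distinct head relation symbols. -/
def isViewSet (σ : Schema) (𝒱 : Finset CQ) : Prop :=
  (∀ V ∈ 𝒱, isCQ σ V) ∧
  ∀ V ∈ 𝒱, ∀ W ∈ 𝒱, V ≠ W → V.head.rel ≠ W.head.rel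

/-- The 𝒱-defined database 𝒱(D). -/
def viewDB (𝒱 : Finset CQ) (D : Database) : Database :=
  ⋃ V ∈ 𝒱, evalCQ V D

/-- `Q'` is a CQ over the schema σ_𝒱 of the head relations of the views 𝒱. -/
def overViews (𝒱 : Finset CQ) (Q' : CQ) : Prop :=
  Q'.body.Nonempty ∧
  (∀ A ∈ Q'.body, ∃ V ∈ 𝒱, A.rel = V.head.rel ∧ A.args.length = V.head.args.length) ∧
  (∀ V ∈ 𝒱, Q'.head.rel ≠ V.head.rel) ∧
  Q'.head.vars ⊆ varsOf Q'.body

/-- `Q'` is a 𝒱-rewriting of `Q`: `Q'` is over σ_𝒱 and `Q'(𝒱(D)) = Q(D)`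
for every (finite) database `D` over σ. -/
def isRewriting (σ : Schema) (𝒱 : Finset CQ) (Q Q' : CQ) : Prop :=
  overViews 𝒱 Q' ∧
  ∀ D : Database, D.Finite → isDBOver σ D →
    evalCQ Q' (viewDB 𝒱 D) = evalCQ Q D

/-- `T` is a join tree for the atom set `B`. -/
def joinTreeProp (B : Finset Atom) (T : SimpleGraph {A : Atom // A ∈ B}) : Prop :=
  T.IsTree ∧
  ∀ (x : ℕ) (A A' : {A : Atom // A ∈ B}) (p : T.Walk A A'), p.IsPath →
    x ∈ A.1.vars → x ∈ A'.1.vars → ∀ C ∈ p.support, x ∈ C.1.vars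

/-- The atom set `B` has a join tree. -/
def hasJoinTree (B : Finset Atom) : Prop :=
  ∃ T : SimpleGraph {A : Atom // A ∈ B}, joinTreeProp B T

/-- A conjunctive query is acyclic if its body has a join tree. -/
def isAcyclicCQ (Q : CQ) : Prop := hasJoinTree Q.body

/-- A conjunctive query is free-connex acyclic. -/
def isFreeConnex (Q : CQ) : Prop :=
  isAcyclicCQ Q ∧ hasJoinTree (insert Q.head Q.body)

/-- The bridge variables of `𝒜 ⊆ body(Q)`. -/
def bvars (Q : CQ) (𝒜 : Finset Atom) : Finset ℕ :=
  varsOf 𝒜 ∩ (Q.head.vars ∪ varsOf (Q.body \ 𝒜))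

/-- An application of a view `V`: a substitution that does not unify any
quantified variable of `V` with another variable of `V`. -/
def isApplication (V : CQ) (α : ℕ → ℕ) : Prop :=
  ∀ x ∈ varsOf V.body, x ∉ V.head.vars →
    ∀ y ∈ CQ.vars V, y ≠ x → α x ≠ α y

/-- The query α(V). -/
def applyCQ (α : ℕ → ℕ) (V : CQ) : CQ :=
  ⟨mapAtom α V.head, V.body.image (mapAtom α)⟩

/-- `(𝒜, V, α, ψ)` is a cover description for `Q`. -/
def isCoverDesc (Q : CQ) (𝒜 : Finset Atom) (V : CQ) (α ψ : ℕ → ℕ) : Prop :=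
  𝒜 ⊆ Q.body ∧ isApplication V α ∧
  𝒜 ⊆ V.body.image (mapAtom α) ∧
  bvars Q 𝒜 ⊆ V.head.vars.image α ∧
  isBodyHom ψ (applyCQ α V) Q ∧
  ∀ x ∈ varsOf 𝒜, ψ x = x

/-- A cover partition for `Q` over `𝒱`: a collection of cover descriptions
whose atom sets partition `body(Q)`. -/
def isCoverPartition (Q : CQ) (𝒱 : Finset CQ) (m : ℕ)
    (𝒜 : Fin m → Finset Atom) (V : Fin m → CQ) (α ψ : Fin m → ℕ → ℕ) : Prop :=
  (∀ i, V i ∈ 𝒱 ∧ isCoverDesc Q (𝒜 i) (V i) (α i) (ψ i)) ∧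
  ∀ A ∈ Q.body, ∃! i, A ∈ 𝒜 i

/-- Consistency of a cover partition: a variable of any `α_j(V_j)` lies in the
range of another `α_i` only if it also lies in `bvars(𝒜_j)`. -/
def isConsistent (Q : CQ) (m : ℕ) (𝒜 : Fin m → Finset Atom) (V : Fin m → CQ)
    (α : Fin m → ℕ → ℕ) : Prop :=
  ∀ i j : Fin m, i ≠ j → ∀ z ∈ CQ.vars (applyCQ (α j) (V j)),
    (∃ x ∈ CQ.vars (V i), α i x = z) → z ∈ bvars Q (𝒜 j)

/-- The query `Q_𝒞` induced by a (consistent) cover partition. -/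
def inducedCQ (Q : CQ) (m : ℕ) (V : Fin m → CQ) (α : Fin m → ℕ → ℕ) : CQ :=
  ⟨Q.head, Finset.image (fun i => mapAtom (α i) (V i).head) Finset.univ⟩

/-- Quantified variable disjointness for a family of view applications. -/
def QVD (m : ℕ) (V : Fin m → CQ) (α : Fin m → ℕ → ℕ) : Prop :=
  ∀ i j : Fin m, i ≠ j → ∀ x ∈ varsOf (V i).body, x ∉ (V i).head.vars →
    ∀ y ∈ CQ.vars (V j), α i x ≠ α j y

/-- `QE` is an expansion of `Q'` with respect to the views `𝒱`. -/
def isExpansion (𝒱 : Finset CQ) (Q' QE : CQ) : Prop :=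
  ∃ (m : ℕ) (A' : Fin m → Atom) (V : Fin m → CQ) (α : Fin m → ℕ → ℕ),
    (∀ i, V i ∈ 𝒱 ∧ isApplication (V i) (α i) ∧ A' i = mapAtom (α i) (V i).head) ∧
    Q'.body = Finset.image A' Finset.univ ∧
    QVD m V α ∧
    QE.head = Q'.head ∧
    QE.body = Finset.biUnion Finset.univ (fun i => (V i).body.image (mapAtom (α i)))

/-- `atoms(x)`: the body atoms of `Q` containing the variable `x`. -/
def atomsWith (Q : CQ) (x : ℕ) : Finset Atom :=
  Q.body.filter (fun A => x ∈ A.vars)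

/-- Hierarchical conjunctive queries. -/
def isHierarchical (Q : CQ) : Prop :=
  ∀ x y : ℕ, atomsWith Q x ⊆ atomsWith Q y ∨ atomsWith Q y ⊆ atomsWith Q x ∨
    atomsWith Q x ∩ atomsWith Q y = ∅

/-- q-hierarchical conjunctive queries. -/
def isQHierarchical (Q : CQ) : Prop :=
  isHierarchical Q ∧ ∀ x y : ℕ, atomsWith Q x ⊂ atomsWith Q y →
    x ∈ Q.head.vars → y ∈ Q.head.vars

/-- `P` is a partition of `body(Q)` witnessing weak head arity at most `k`. -/
def witnessesWHA (Q : CQ) (k n : ℕ) (P : Fin n → Finset Atom) : Prop :=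
  (∀ i, (P i).Nonempty) ∧ (∀ i, P i ⊆ Q.body) ∧ (∀ A ∈ Q.body, ∃! i, A ∈ P i) ∧
  (∀ i, (varsOf (P i) ∩ Q.head.vars).card ≤ k) ∧
  (∀ i j, i ≠ j → ∀ x ∈ varsOf (P i), x ∈ varsOf (P j) → x ∈ Q.head.vars)

/-- `Q` has weak head arity at most `k`. -/
def hasWHAle (Q : CQ) (k : ℕ) : Prop := ∃ n P, witnessesWHA Q k n P

/-- The weak head arity of `Q`. -/
noncomputable def weakHeadArity (Q : CQ) : ℕ := sInf {k | hasWHAle Q k}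

/-- The cover graph of `Q`: vertices are the body atoms, with an edge between
two atoms iff they share a variable not occurring in the head. -/
def coverGraph (Q : CQ) : SimpleGraph {A : Atom // A ∈ Q.body} :=
  SimpleGraph.fromRel (fun A B => ∃ x, x ∈ A.1.vars ∧ x ∈ B.1.vars ∧ x ∉ Q.head.vars)

/-- A subset `s` of the atom set `B` is connected in the (join) tree `T`. -/
def connectedIn (B : Finset Atom) (T : SimpleGraph {A : Atom // A ∈ B}) (s : Finset Atom) : Prop :=
  (T.induce {A : {A : Atom // A ∈ B} | A.1 ∈ s}).Connected

theorem Atom.mem_vars {A : Atom} {x : ℕ} : x ∈ A.vars ↔ x ∈ A.args := by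
  simp [Atom.vars]

theorem mem_vars_mapAtom {f : ℕ → ℕ} {A : Atom} {y : ℕ} :
    y ∈ (mapAtom f A).vars ↔ ∃ x ∈ A.vars, f x = y := by
  simp [Atom.vars, mapAtom]

theorem mapAtom_mapAtom (f g : ℕ → ℕ) (A : Atom) :
    mapAtom f (mapAtom g A) = mapAtom (fun x => f (g x)) A := by
  simp [mapAtom, Function.comp_def]

theorem mapAtom_congr_iff {f g : ℕ → ℕ} {A : Atom} :
    mapAtom f A = mapAtom g A ↔ ∀ x ∈ A.vars, f x = g x := by
  simp [mapAtom, Atom.mem_vars]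

theorem mapAtom_id (A : Atom) : mapAtom (fun x => x) A = A := by
  simp [mapAtom]

theorem mem_varsOf {B : Finset Atom} {x : ℕ} : x ∈ varsOf B ↔ ∃ A ∈ B, x ∈ A.vars := by
  simp [varsOf]

theorem mem_viewDB {𝒱 : Finset CQ} {D : Database} {F : Atom} :
    F ∈ viewDB 𝒱 D ↔ ∃ V ∈ 𝒱, ∃ ν : ℕ → ℕ,
      (∀ A ∈ V.body, mapAtom ν A ∈ D) ∧ mapAtom ν V.head = F := by
  simp [viewDB, evalCQ]

theorem Atom.countable : Countable Atom :=
  Function.Injective.countable (f := fun A : Atom => (A.rel, A.args)) (by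
    rintro ⟨r, l⟩ ⟨r', l'⟩ h
    simpa using h)

/-- The variables of a safe query are q-hierarchical iff any two variables sharing a body atom
are comparable, with comparability respecting the head. -/
theorem isQHierarchical_iff {Q : CQ} (hs : Q.head.vars ⊆ varsOf Q.body) :
    isQHierarchical Q ↔
      (∀ x y, ∀ A ∈ Q.body, x ∈ A.vars → y ∈ A.vars →
        (∀ C ∈ Q.body, x ∈ C.vars → y ∈ C.vars) ∨ (∀ C ∈ Q.body, y ∈ C.vars → x ∈ C.vars)) ∧
      (∀ x y, ∀ A ∈ Q.body, x ∈ A.vars → y ∈ A.vars →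
        (∃ C ∈ Q.body, y ∈ C.vars ∧ x ∉ C.vars) → x ∈ Q.head.vars → y ∈ Q.head.vars) := by
  have hmem : ∀ x A, A ∈ atomsWith Q x ↔ A ∈ Q.body ∧ x ∈ A.vars := by simp [atomsWith]
  have hsub : ∀ x y, atomsWith Q x ⊆ atomsWith Q y ↔
      ∀ C ∈ Q.body, x ∈ C.vars → y ∈ C.vars := by
    intro x y
    simp only [Finset.subset_iff, hmem]
    grind
  constructor
  · rintro ⟨h1, h2⟩
    have key : ∀ x y, ∀ A ∈ Q.body, x ∈ A.vars → y ∈ A.vars →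
        (∀ C ∈ Q.body, x ∈ C.vars → y ∈ C.vars) ∨
          (∀ C ∈ Q.body, y ∈ C.vars → x ∈ C.vars) := by
      intro x y A hA hx hy
      rcases h1 x y with h | h | h
      · exact Or.inl ((hsub _ _).1 h)
      · exact Or.inr ((hsub _ _).1 h)
      · have : A ∈ atomsWith Q x ∩ atomsWith Q y :=
          Finset.mem_inter.2 ⟨(hmem _ _).2 ⟨hA, hx⟩, (hmem _ _).2 ⟨hA, hy⟩⟩
        simp [h] at this
    refine ⟨key, fun x y A hA hx hy ⟨C, hC, hyC, hxC⟩ hh => h2 x y ⟨?_, ?_⟩ hh⟩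
    · rw [hsub]
      exact (key x y A hA hx hy).resolve_right fun h => hxC (h C hC hyC)
    · rw [hsub]
      exact fun h => hxC (h C hC hyC)
  · rintro ⟨h1, h2⟩
    refine ⟨fun x y => ?_, fun x y hxy hx => ?_⟩
    · rw [hsub, hsub, ← or_assoc, or_iff_not_imp_right, ← Ne, ← Finset.nonempty_iff_ne_empty]
      rintro ⟨A, hA⟩
      simp only [Finset.mem_inter, hmem] at hA
      exact h1 x y A hA.1.1 hA.1.2 hA.2.2
    · obtain ⟨A, hA, hxA⟩ := mem_varsOf.1 (hs hx)
      obtain ⟨h3, h4⟩ := hxy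
      rw [hsub] at h3 h4
      push Not at h4
      exact h2 x y A hA hxA (h3 A hA hxA) h4 hx

/-- A self-map of a finite set has an idempotent positive iterate. -/
theorem exists_idempotent_iterate (f : ℕ → ℕ) (S : Finset ℕ) (hf : ∀ x ∈ S, f x ∈ S) :
    ∃ k, ∀ x ∈ S, f^[k + 1] (f^[k + 1] x) = f^[k + 1] x := by
  let F : S → S := fun x => ⟨f x, hf x x.2⟩
  have hF : ∀ n (x : S), ((F^[n] x : S) : ℕ) = f^[n] x := by
    intro n
    induction n with
    | zero => intro x; rfl
    | succ n ih => intro x; rw [Function.iterate_succ_apply, ih, Function.iterate_succ_apply]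
  obtain ⟨a, p, hp⟩ : ∃ a p, F^[a + (p + 1)] = F^[a] := by
    obtain ⟨m, n, hne, h⟩ := Finite.exists_ne_map_eq_of_infinite (fun n : ℕ => F^[n])
    rcases lt_or_gt_of_ne hne with hlt | hlt
    · exact ⟨m, n - m - 1, by rw [show m + (n - m - 1 + 1) = n by omega]; exact h.symm⟩
    · exact ⟨n, m - n - 1, by rw [show n + (m - n - 1 + 1) = m by omega]; exact h⟩
  have hper : ∀ t d, F^[d + a + t * (p + 1)] = F^[d + a] := by
    intro t d
    induction t with
    | zero => simp
    | succ t ih =>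
      rw [show d + a + (t + 1) * (p + 1) = (d + t * (p + 1)) + (a + (p + 1)) by ring,
        Function.iterate_add, hp, ← Function.iterate_add,
        show d + t * (p + 1) + a = d + a + t * (p + 1) by ring, ih]
  refine ⟨(a + 1) * (p + 1) - 1, fun x hx => ?_⟩
  have hk : (a + 1) * (p + 1) - 1 + 1 = (a + 1) * (p + 1) :=
    Nat.sub_add_cancel (Nat.mul_pos (by omega) (by omega))
  have hd : (a * p + p + 1) + a = (a + 1) * (p + 1) := by ring
  have := hper (a + 1) (a * p + p + 1)
  rw [hd] at this
  have h2 := congrArg (fun G => ((G ⟨x, hx⟩ : S) : ℕ)) this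
  simp only [hF] at h2
  rw [hk, ← Function.iterate_add_apply]
  exact h2

/-- A retract `body` of `Q.body` in which every atom is covered by an atom of a view mapping into
`Q`. A variable `x` is either matched only with head variables of views (`loc x = none`) or with
exactly one quantified variable `v` of one view copy `i` (`loc x = some (i, v)`). -/
structure ViewCover (𝒱 : Finset CQ) (Q : CQ) where
  body : Finset Atom
  retr : ℕ → ℕ
  loc : ℕ → Option (Atom × ℕ)
  view : Atom → CQ
  hom : Atom → ℕ → ℕ
  idx : Atom → Atom
  preim : Atom → Atom
  body_subset : body ⊆ Q.body
  retr_mem : ∀ A ∈ Q.body, mapAtom retr A ∈ body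
  retr_head : ∀ x ∈ Q.head.vars, retr x = x
  loc_head : ∀ x ∈ Q.head.vars, loc x = none
  view_mem : ∀ A ∈ body, view (idx A) ∈ 𝒱
  hom_mem : ∀ A ∈ body, ∀ C ∈ (view (idx A)).body, mapAtom (hom (idx A)) C ∈ Q.body
  preim_mem : ∀ A ∈ body, preim A ∈ (view (idx A)).body
  preim_rel : ∀ A ∈ body, (preim A).rel = A.rel
  preim_args : ∀ A ∈ body, List.Forall₂ (fun x v =>
    (v ∈ (view (idx A)).head.vars ∧ loc x = none ∧ x = hom (idx A) v) ∨
    (v ∉ (view (idx A)).head.vars ∧ loc x = some (idx A, v))) A.args (preim A).args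

open Classical in
/-- A rewriting yields a cover, by evaluating it on the canonical database of `Q` and then
evaluating `Q` on the canonical database of the resulting expansion. -/
theorem nonempty_viewCover {σ : Schema} {𝒱 : Finset CQ} (h𝒱 : isViewSet σ 𝒱) {Q : CQ}
    (hQ : isCQ σ Q) {Q' : CQ} (hrw : isRewriting σ 𝒱 Q Q') : Nonempty (ViewCover 𝒱 Q) := by
  have := Atom.countable
  obtain ⟨ι, hι⟩ := exists_injective_nat (Option Atom × ℕ)
  have hcanon : Q.head ∈ evalCQ Q' (viewDB 𝒱 (Q.body : Set Atom)) := by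
    rw [hrw.2 _ Q.body.finite_toSet (fun F hF => hQ.2.1 F hF)]
    exact ⟨fun x => x, fun A hA => by simpa [mapAtom_id] using hA, mapAtom_id _⟩
  obtain ⟨ν, hν, hνh⟩ := hcanon
  have hex : ∀ B, ∃ (V : CQ) (μ : ℕ → ℕ), B ∈ Q'.body →
      V ∈ 𝒱 ∧ (∀ C ∈ V.body, mapAtom μ C ∈ Q.body) ∧ mapAtom μ V.head = mapAtom ν B := by
    intro B
    by_cases hB : B ∈ Q'.body
    · obtain ⟨V, hV, μ, h1, h2⟩ := mem_viewDB.1 (hν B hB)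
      exact ⟨V, μ, fun _ => ⟨hV, h1, h2⟩⟩
    · exact ⟨Q, id, fun h => absurd h hB⟩
  choose V μ hVμ using hex
  let β : Atom → ℕ → Option Atom × ℕ := fun B v =>
    if v ∈ (V B).head.vars then (none, μ B v) else (some B, v)
  let E : Finset Atom :=
    Q'.body.biUnion fun B => (V B).body.image (mapAtom fun v => ι (β B v))
  have hE : ∀ B ∈ Q'.body, ∀ C ∈ (V B).body, mapAtom (fun v => ι (β B v)) C ∈ E := by
    intro B hB C hC
    exact Finset.mem_biUnion.2 ⟨B, hB, Finset.mem_image_of_mem _ hC⟩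
  have hEσ : isDBOver σ (E : Set Atom) := by
    intro F hF
    obtain ⟨B, hB, hF⟩ := Finset.mem_biUnion.1 hF
    obtain ⟨C, hC, rfl⟩ := Finset.mem_image.1 hF
    have := (h𝒱.1 _ (hVμ B hB).1).2.1 C hC
    exact ⟨this.1, by simpa [mapAtom] using this.2⟩
  have hexp : mapAtom (fun x => ι (none, x)) Q.head ∈ evalCQ Q (E : Set Atom) := by
    rw [← hrw.2 _ E.finite_toSet hEσ]
    refine ⟨fun y => ι (none, ν y), fun B hB => ?_, ?_⟩
    · refine mem_viewDB.2 ⟨V B, (hVμ B hB).1, fun v => ι (β B v), hE B hB, ?_⟩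
      rw [← mapAtom_mapAtom (fun x => ι (none, x)) ν, ← (hVμ B hB).2.2, mapAtom_mapAtom,
        mapAtom_congr_iff]
      intro v hv
      simp [β, hv]
    · rw [← mapAtom_mapAtom (fun x => ι (none, x)) ν, hνh]
  obtain ⟨φ₀, hφ₀, hφ₀h⟩ := hexp
  rw [mapAtom_congr_iff] at hφ₀h
  let dec : ℕ → Option Atom × ℕ := Function.invFun ι
  have hdec : ∀ t, dec (ι t) = t := Function.leftInverse_invFun hι
  let π₀ : Option Atom × ℕ → ℕ := fun t => t.1.elim t.2 fun B => μ B t.2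
  let π : ℕ → ℕ := fun n => π₀ (dec n)
  have hπ₀β : ∀ B v, π₀ (β B v) = μ B v := by
    intro B v
    by_cases h : v ∈ (V B).head.vars <;> simp [β, h, π₀]
  have hπβ : ∀ B v, π (ι (β B v)) = μ B v := by
    intro B v
    simp only [π, hdec, hπ₀β]
  have hπE : ∀ F ∈ E, mapAtom π F ∈ Q.body := by
    intro F hF
    obtain ⟨B, hB, hF⟩ := Finset.mem_biUnion.1 hF
    obtain ⟨C, hC, rfl⟩ := Finset.mem_image.1 hF
    simpa only [mapAtom_mapAtom, hπβ] using (hVμ B hB).2.1 C hC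
  let p : ℕ → ℕ := fun x => π (φ₀ x)
  have hp : ∀ A ∈ Q.body, mapAtom p A ∈ Q.body := by
    intro A hA
    simpa only [mapAtom_mapAtom] using hπE _ (hφ₀ A hA)
  have hpn : ∀ n, ∀ A ∈ Q.body, mapAtom p^[n] A ∈ Q.body := by
    intro n
    induction n with
    | zero => intro A hA; simpa [mapAtom] using hA
    | succ n ih =>
      intro A hA
      have := ih _ (hp A hA)
      rwa [mapAtom_mapAtom] at this
  have hph : ∀ x ∈ Q.head.vars, p x = x := by
    intro x hx
    simp only [p, hφ₀h x hx, π, hdec]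
    rfl
  have hpnh : ∀ n, ∀ x ∈ Q.head.vars, p^[n] x = x := fun n x hx =>
    Function.iterate_fixed (hph x hx) n
  have hpv : ∀ x ∈ varsOf Q.body, p x ∈ varsOf Q.body := by
    intro x hx
    obtain ⟨A, hA, hxA⟩ := mem_varsOf.1 hx
    exact mem_varsOf.2 ⟨_, hp A hA, mem_vars_mapAtom.2 ⟨x, hxA, rfl⟩⟩
  obtain ⟨k, hk⟩ := exists_idempotent_iterate p _ hpv
  let φ : ℕ → Option Atom × ℕ := fun x => dec (φ₀ (p^[k] x))
  let body := Q.body.image (mapAtom p^[k + 1])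
  have hπφ : ∀ A ∈ body, ∀ x ∈ A.vars, π₀ (φ x) = x := by
    intro A hA x hx
    obtain ⟨A₀, hA₀, rfl⟩ := Finset.mem_image.1 hA
    obtain ⟨x, hx₀, rfl⟩ := mem_vars_mapAtom.1 hx
    have := hk x (mem_varsOf.2 ⟨A₀, hA₀, hx₀⟩)
    rwa [Function.iterate_succ_apply' p k (p^[k + 1] x)] at this
  have hbody : body ⊆ Q.body := by
    intro A hA
    obtain ⟨A₀, hA₀, rfl⟩ := Finset.mem_image.1 hA
    exact hpn _ A₀ hA₀
  have hcov : ∀ A, ∃ B C, A ∈ body → B ∈ Q'.body ∧ C ∈ (V B).body ∧ C.rel = A.rel ∧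
      A.args.map φ = C.args.map (β B) := by
    intro A
    by_cases hA : A ∈ body
    · have h1 := hφ₀ _ (hpn k A (hbody hA))
      obtain ⟨B, hB, hF⟩ := Finset.mem_biUnion.1 h1
      obtain ⟨C, hC, h⟩ := Finset.mem_image.1 hF
      refine ⟨B, C, fun _ => ⟨hB, hC, (congrArg Atom.rel h :), ?_⟩⟩
      have h2 := congrArg (fun F : Atom => F.args.map dec) h
      simp only [mapAtom, List.map_map] at h2
      refine Eq.trans ?_ (h2.symm.trans ?_)
      · rfl
      · exact List.map_congr_left fun v _ => hdec _
    · exact ⟨A, A, fun h => absurd h hA⟩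
  choose idx preim hip using hcov
  refine ⟨{
    body := body
    retr := p^[k + 1]
    loc := fun x => (φ x).1.map fun B => (B, (φ x).2)
    view := V
    hom := μ
    idx := idx
    preim := preim
    body_subset := hbody
    retr_mem := fun A hA => Finset.mem_image_of_mem _ hA
    retr_head := hpnh _
    loc_head := ?_
    view_mem := fun A hA => (hVμ _ (hip A hA).1).1
    hom_mem := fun A hA => (hVμ _ (hip A hA).1).2.1
    preim_mem := fun A hA => (hip A hA).2.1
    preim_rel := fun A hA => (hip A hA).2.2.1
    preim_args := ?_ }⟩
  · intro x hx
    simp [φ, hpnh k x hx, hφ₀h x hx, hdec]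
  · intro A hA
    have h := (hip A hA).2.2.2
    have h2 : List.Forall₂ (fun x v => φ x = β (idx A) v) A.args (preim A).args := by
      rw [← List.forall₂_eq_eq_eq, List.forall₂_map_left_iff, List.forall₂_map_right_iff] at h
      exact h
    have h3 : ∀ x ∈ A.args, π₀ (φ x) = x := fun x hx =>
      hπφ A hA x (Atom.mem_vars.2 hx)
    have h4 := (List.forall₂_and_left (p := fun x => π₀ (φ x) = x) _ _).2 ⟨h3, h2⟩
    refine h4.imp fun x v hxv => ?_
    obtain ⟨hx, hxv⟩ := hxv
    by_cases hv : v ∈ (V (idx A)).head.vars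
    · refine Or.inl ⟨hv, ?_, ?_⟩
      · simp [hxv, β, hv]
      · rw [← hπ₀β, ← hxv, hx]
    · refine Or.inr ⟨hv, ?_⟩
      simp [hxv, β, hv]

/-- Choice of class representatives for an equivalence relation on a finite set. -/
theorem exists_representative {α : Type*} (s : Finset α) (r : α → α → Prop)
    (hrefl : ∀ a ∈ s, r a a) (hsymm : ∀ a ∈ s, ∀ b ∈ s, r a b → r b a)
    (htrans : ∀ a ∈ s, ∀ b ∈ s, ∀ c ∈ s, r a b → r b c → r a c) :
    ∃ rep : α → α, ∀ a ∈ s, rep a ∈ s ∧ r (rep a) a ∧ ∀ b ∈ s, (rep a = rep b ↔ r a b) := by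
  classical
  let S : Setoid s :=
    { r := fun a b => r a b
      iseqv := ⟨fun a => hrefl a a.2, fun {a b} => hsymm a a.2 b b.2,
        fun {a b c} => htrans a a.2 b b.2 c c.2⟩ }
  let rep : α → α := fun a =>
    if h : a ∈ s then ((Quotient.mk S ⟨a, h⟩).out : α) else a
  have hrep : ∀ a (h : a ∈ s), rep a = ((Quotient.mk S ⟨a, h⟩).out : α) :=
    fun a h => by simp [rep, h]
  refine ⟨rep, fun a ha => ⟨?_, ?_, fun b hb => ?_⟩⟩
  · rw [hrep a ha]
    exact Subtype.coe_prop _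
  · rw [hrep a ha]
    exact Quotient.mk_out (s := S) ⟨a, ha⟩
  · rw [hrep a ha, hrep b hb, Subtype.coe_inj, Quotient.out_inj, Quotient.eq]
    exact Iff.rfl

theorem exists_of_forall₂_of_mem {α β : Type*} {R : α → β → Prop} {l : List α} {l' : List β}
    (h : List.Forall₂ R l l') {a : α} (ha : a ∈ l) : ∃ b ∈ l', R a b := by
  induction h with
  | nil => simp at ha
  | cons hR _ ih =>
    rcases List.mem_cons.1 ha with rfl | ha
    · exact ⟨_, List.mem_cons_self, hR⟩
    · obtain ⟨b, hb, h⟩ := ih ha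
      exact ⟨b, List.mem_cons_of_mem _ hb, h⟩

namespace ViewCover

variable {𝒱 : Finset CQ} {Q : CQ}

/-- Two atoms are linked if they are equal or share a variable matched with a quantified view
variable. -/
def Linked (T : ViewCover 𝒱 Q) (A A' : Atom) : Prop :=
  A = A' ∨ ∃ z, T.loc z ≠ none ∧ z ∈ A.vars ∧ z ∈ A'.vars

theorem Linked.symm {T : ViewCover 𝒱 Q} {A A' : Atom} (h : T.Linked A A') : T.Linked A' A := by
  rcases h with rfl | ⟨z, hz, h, h'⟩
  · exact Or.inl rfl
  · exact Or.inr ⟨z, hz, h', h⟩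

theorem loc_cases (T : ViewCover 𝒱 Q) {A : Atom} (hA : A ∈ T.body) {x : ℕ} (hx : x ∈ A.vars) :
    (T.loc x = none ∧ ∃ v ∈ (T.view (T.idx A)).head.vars, x = T.hom (T.idx A) v) ∨
      ∃ v, T.loc x = some (T.idx A, v) := by
  obtain ⟨v, -, ⟨hv, h, hx⟩ | ⟨-, h⟩⟩ :=
    exists_of_forall₂_of_mem (T.preim_args A hA) (Atom.mem_vars.1 hx)
  · exact Or.inl ⟨h, v, hv, hx⟩
  · exact Or.inr ⟨v, h⟩

theorem Linked.idx_eq {T : ViewCover 𝒱 Q} {A A' : Atom} (hA : A ∈ T.body) (hA' : A' ∈ T.body)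
    (h : T.Linked A A') : T.idx A = T.idx A' := by
  rcases h with rfl | ⟨z, hz, h, h'⟩
  · rfl
  · rcases T.loc_cases hA h with ⟨h1, -⟩ | ⟨v, h1⟩
    · exact absurd h1 hz
    · rcases T.loc_cases hA' h' with ⟨h2, -⟩ | ⟨v', h2⟩
      · exact absurd h2 hz
      · rw [h1] at h2
        simpa using congrArg (Option.map Prod.fst) h2

theorem exists_rep (T : ViewCover 𝒱 Q)
    (hier : ∀ x y, ∀ A ∈ Q.body, x ∈ A.vars → y ∈ A.vars →
      (∀ C ∈ Q.body, x ∈ C.vars → y ∈ C.vars) ∨ (∀ C ∈ Q.body, y ∈ C.vars → x ∈ C.vars)) :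
    ∃ rep : Atom → Atom, ∀ A ∈ T.body, rep A ∈ T.body ∧ T.Linked (rep A) A ∧
      ∀ A' ∈ T.body, (rep A = rep A' ↔ T.Linked A A') := by
  refine exists_representative T.body T.Linked (fun _ _ => Or.inl rfl)
    (fun _ _ _ _ h => h.symm) ?_
  rintro A hA B hB C hC (rfl | ⟨z, hz, h1, h2⟩) (rfl | ⟨z', hz', h3, h4⟩)
  · exact Or.inl rfl
  · exact Or.inr ⟨z', hz', h3, h4⟩
  · exact Or.inr ⟨z, hz, h1, h2⟩
  · rcases hier z z' B (T.body_subset hB) h2 h3 with h | h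
    · exact Or.inr ⟨z', hz', h A (T.body_subset hA) h1, h4⟩
    · exact Or.inr ⟨z, hz, h1, h C (T.body_subset hC) h4⟩

/-- A variable is shared if it is a head variable or occurs in two classes of atoms. -/
def Shared (T : ViewCover 𝒱 Q) (rep : Atom → Atom) (x : ℕ) : Prop :=
  x ∈ Q.head.vars ∨
    ∃ A ∈ T.body, ∃ A' ∈ T.body, x ∈ A.vars ∧ x ∈ A'.vars ∧ rep A ≠ rep A'

/-- The bridge variables of the class represented by `c`. -/
def Bridge (T : ViewCover 𝒱 Q) (rep : Atom → Atom) (c : Atom) (x : ℕ) : Prop :=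
  T.Shared rep x ∧ ∃ A ∈ T.body, x ∈ A.vars ∧ rep A = c

open Classical in
/-- The renaming which keeps the bridge variables of a class and makes all others fresh. -/
noncomputable def rename (T : ViewCover 𝒱 Q) (rep : Atom → Atom) (ι : Option Atom × ℕ → ℕ)
    (c : Atom) (x : ℕ) : ℕ :=
  if T.Bridge rep c x then ι (none, x) else ι (some c, x)

/-- The view atom of the class represented by `c`. -/
noncomputable def viewAtom (T : ViewCover 𝒱 Q) (rep : Atom → Atom) (ι : Option Atom × ℕ → ℕ)
    (c : Atom) : Atom :=
  mapAtom (fun v => T.rename rep ι c (T.hom (T.idx c) v)) (T.view (T.idx c)).head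

/-- The query with one view atom for each class of linked atoms. -/
noncomputable def query (T : ViewCover 𝒱 Q) (rep : Atom → Atom) (ι : Option Atom × ℕ → ℕ) : CQ :=
  ⟨mapAtom (fun x => ι (none, x)) Q.head, T.body.image fun A => T.viewAtom rep ι (rep A)⟩

section

variable {T : ViewCover 𝒱 Q} {rep : Atom → Atom} {ι : Option Atom × ℕ → ℕ}

theorem forall_mem_query_body {P : Atom → Prop} :
    (∀ F ∈ (T.query rep ι).body, P F) ↔ ∀ A ∈ T.body, P (T.viewAtom rep ι (rep A)) := by
  simp [query]

theorem mem_head_query (hι : ι.Injective) {x : ℕ} :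
    ι (none, x) ∈ (T.query rep ι).head.vars ↔ x ∈ Q.head.vars := by
  simp [query, mem_vars_mapAtom, hι.eq_iff]

theorem exists_mem_body (hs : Q.head.vars ⊆ varsOf Q.body) {x : ℕ} (hx : x ∈ Q.head.vars) :
    ∃ A ∈ T.body, x ∈ A.vars := by
  obtain ⟨A, hA, hxA⟩ := mem_varsOf.1 (hs hx)
  exact ⟨_, T.retr_mem A hA, mem_vars_mapAtom.2 ⟨x, hxA, T.retr_head x hx⟩⟩

theorem mem_vars_viewAtom {c : Atom} {y : ℕ} (hy : y ∈ (T.viewAtom rep ι c).vars) :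
    (∃ x, y = ι (none, x) ∧ T.Bridge rep c x) ∨ ∃ x, y = ι (some c, x) := by
  obtain ⟨v, -, rfl⟩ := mem_vars_mapAtom.1 hy
  by_cases h : T.Bridge rep c (T.hom (T.idx c) v)
  · exact Or.inl ⟨_, by simp [rename, h], h⟩
  · exact Or.inr ⟨T.hom (T.idx c) v, by simp [rename, h]⟩

variable (hrep : ∀ A ∈ T.body, rep A ∈ T.body ∧ T.Linked (rep A) A ∧
  ∀ A' ∈ T.body, (rep A = rep A' ↔ T.Linked A A'))
include hrep

theorem idx_rep {A : Atom} (hA : A ∈ T.body) : T.idx (rep A) = T.idx A :=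
  (hrep A hA).2.1.idx_eq (hrep A hA).1 hA

theorem rep_eq_of_loc {A A' : Atom} (hA : A ∈ T.body) (hA' : A' ∈ T.body) {x : ℕ}
    (hx : T.loc x ≠ none) (h : x ∈ A.vars) (h' : x ∈ A'.vars) : rep A = rep A' :=
  ((hrep A hA).2.2 A' hA').2 (Or.inr ⟨x, hx, h, h'⟩)

theorem Shared.loc_eq_none {x : ℕ} (hx : T.Shared rep x) : T.loc x = none := by
  rcases hx with hx | ⟨A, hA, A', hA', h, h', hne⟩
  · exact T.loc_head x hx
  · by_contra hx
    exact hne (rep_eq_of_loc hrep hA hA' hx h h')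

theorem Bridge.mem_viewAtom {c : Atom} {x : ℕ} (h : T.Bridge rep c x) :
    ι (none, x) ∈ (T.viewAtom rep ι c).vars := by
  obtain ⟨A, hA, hx, rfl⟩ := h.2
  rcases T.loc_cases hA hx with ⟨-, v, hv, hxv⟩ | ⟨v, hv⟩
  · refine mem_vars_mapAtom.2 ⟨v, by rwa [idx_rep hrep hA], ?_⟩
    rw [idx_rep hrep hA, ← hxv, rename, if_pos h]
  · simp [h.1.loc_eq_none hrep] at hv

theorem mem_viewAtom_iff (hι : ι.Injective) {c : Atom} {x : ℕ} :
    ι (none, x) ∈ (T.viewAtom rep ι c).vars ↔ T.Bridge rep c x := by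
  refine ⟨fun h => ?_, fun h => h.mem_viewAtom hrep⟩
  rcases mem_vars_viewAtom h with ⟨x', h, hb⟩ | ⟨x', h⟩
  · cases hι h
    exact hb
  · cases hι h

theorem query_safe (hs : Q.head.vars ⊆ varsOf Q.body) :
    (T.query rep ι).head.vars ⊆ varsOf (T.query rep ι).body := by
  intro y hy
  obtain ⟨x, hx, rfl⟩ := mem_vars_mapAtom.1 hy
  obtain ⟨A, hA, hxA⟩ := exists_mem_body (T := T) hs hx
  refine mem_varsOf.2 ⟨_, Finset.mem_image_of_mem _ hA, ?_⟩
  exact Bridge.mem_viewAtom hrep ⟨Or.inl hx, A, hA, hxA, rfl⟩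

variable (hier : ∀ x y, ∀ A ∈ Q.body, x ∈ A.vars → y ∈ A.vars →
    (∀ C ∈ Q.body, x ∈ C.vars → y ∈ C.vars) ∨ (∀ C ∈ Q.body, y ∈ C.vars → x ∈ C.vars))
  (qhier : ∀ x y, ∀ A ∈ Q.body, x ∈ A.vars → y ∈ A.vars →
    (∃ C ∈ Q.body, y ∈ C.vars ∧ x ∉ C.vars) → x ∈ Q.head.vars → y ∈ Q.head.vars)
include hier qhier

theorem Bridge.mem_vars {A : Atom} (hA : A ∈ T.body) {x : ℕ} (h : T.Bridge rep (rep A) x) :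
    x ∈ A.vars := by
  obtain ⟨hs, B, hB, hxB, hBA⟩ := h
  rcases ((hrep B hB).2.2 A hA).1 hBA with rfl | ⟨z, hz, hzB, hzA⟩
  · exact hxB
  by_contra hxA
  have hxz : ∀ C ∈ Q.body, x ∈ C.vars → z ∈ C.vars :=
    (hier x z B (T.body_subset hB) hxB hzB).resolve_right fun h =>
      hxA (h A (T.body_subset hA) hzA)
  rcases hs with hx | ⟨C, hC, C', hC', h, h', hne⟩
  · exact hz (T.loc_head z (qhier x z B (T.body_subset hB) hxB hzB
      ⟨A, T.body_subset hA, hzA, hxA⟩ hx))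
  · exact hne (rep_eq_of_loc hrep hC hC' hz (hxz C (T.body_subset hC) h)
      (hxz C' (T.body_subset hC') h'))

theorem isQHierarchical_query (hs : Q.head.vars ⊆ varsOf Q.body) (hι : ι.Injective) :
    isQHierarchical (T.query rep ι) := by
  have hmono : ∀ {x y c c'}, (∀ C ∈ Q.body, x ∈ C.vars → y ∈ C.vars) →
      T.Bridge rep c y → T.Bridge rep c' x → T.Bridge rep c' y := by
    rintro x y c c' hxy hy ⟨-, A, hA, hx, hc⟩
    exact ⟨hy.1, A, hA, hxy A (T.body_subset hA) hx, hc⟩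
  have hfresh : ∀ {c c' x}, ι (some c, x) ∈ (T.viewAtom rep ι c').vars → c' = c := by
    intro c c' x h
    rcases mem_vars_viewAtom h with ⟨x', h, -⟩ | ⟨x', h⟩
    · cases hι h
    · cases hι h
      rfl
  rw [isQHierarchical_iff (query_safe hrep hs)]
  simp only [forall_mem_query_body]
  refine ⟨fun y₁ y₂ A hA h₁ h₂ => ?_, fun y₁ y₂ A hA h₁ h₂ hex hh => ?_⟩
  · rcases mem_vars_viewAtom h₁ with ⟨x₁, rfl, hb₁⟩ | ⟨x₁, rfl⟩
    · rcases mem_vars_viewAtom h₂ with ⟨x₂, rfl, hb₂⟩ | ⟨x₂, rfl⟩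
      · simp only [mem_viewAtom_iff hrep hι]
        exact (hier x₁ x₂ A (T.body_subset hA) (hb₁.mem_vars hrep hier qhier hA)
          (hb₂.mem_vars hrep hier qhier hA)).imp (fun h _ _ => hmono h hb₂)
          (fun h _ _ => hmono h hb₁)
      · exact Or.inr fun C _ hC => by rwa [hfresh hC]
    · exact Or.inl fun C _ hC => by rwa [hfresh hC]
  · obtain ⟨x₁, hx₁, rfl⟩ := mem_vars_mapAtom.1 hh
    obtain ⟨F, hF, hyF, hnF⟩ := hex
    obtain ⟨C, hC, rfl⟩ := Finset.mem_image.1 hF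
    rcases mem_vars_viewAtom h₂ with ⟨x₂, rfl, hb₂⟩ | ⟨x₂, rfl⟩
    · rw [mem_viewAtom_iff hrep hι] at h₁ hyF hnF
      rw [mem_head_query hι]
      refine qhier x₁ x₂ A (T.body_subset hA) (h₁.mem_vars hrep hier qhier hA)
          (hb₂.mem_vars hrep hier qhier hA) ?_ hx₁
      refine ⟨C, T.body_subset hC, hyF.mem_vars hrep hier qhier hC, fun h => hnF ?_⟩
      exact ⟨Or.inl hx₁, C, hC, h, rfl⟩
    · rw [hfresh hyF] at hnF
      exact absurd h₁ hnF

omit hier qhier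

theorem evalCQ_subset_evalCQ_query (hι : ι.Injective) (D : Database) :
    evalCQ Q D ⊆ evalCQ (T.query rep ι) (viewDB 𝒱 D) := by
  rintro F ⟨θ, hθ, rfl⟩
  have hinv : ∀ t, Function.invFun ι (ι t) = t := Function.leftInverse_invFun hι
  refine ⟨fun n => θ (Function.invFun ι n).2, forall_mem_query_body.2 fun A hA => ?_, ?_⟩
  · have hA' := (hrep A hA).1
    refine mem_viewDB.2 ⟨_, T.view_mem _ hA', fun v => θ (T.hom (T.idx (rep A)) v), ?_, ?_⟩
    · intro C hC
      simpa only [mapAtom_mapAtom] using hθ _ (T.hom_mem _ hA' C hC)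
    · rw [viewAtom, mapAtom_mapAtom, mapAtom_congr_iff]
      intro v _
      by_cases h : T.Bridge rep (rep A) (T.hom (T.idx (rep A)) v) <;> simp [rename, h, hinv]
  · simp [query, mapAtom_mapAtom, hinv]

open Classical in
theorem evalCQ_query_subset (hs : Q.head.vars ⊆ varsOf Q.body)
    (hdisj : ∀ V ∈ 𝒱, ∀ W ∈ 𝒱, V ≠ W → V.head.rel ≠ W.head.rel) (D : Database) :
    evalCQ (T.query rep ι) (viewDB 𝒱 D) ⊆ evalCQ Q D := by
  rintro F ⟨θ, hθ, rfl⟩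
  rw [forall_mem_query_body] at hθ
  have hex : ∀ c, ∃ ρ : ℕ → ℕ, c ∈ T.body → rep c = c →
      (∀ C ∈ (T.view (T.idx c)).body, mapAtom ρ C ∈ D) ∧
      ∀ v ∈ (T.view (T.idx c)).head.vars,
        ρ v = θ (T.rename rep ι c (T.hom (T.idx c) v)) := by
    intro c
    by_cases hc : c ∈ T.body ∧ rep c = c
    · have h1 := hθ c hc.1
      rw [hc.2] at h1
      obtain ⟨V, hV, ρ, hρ, h2⟩ := mem_viewDB.1 h1
      have hVe : V = T.view (T.idx c) := by
        by_contra hne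
        exact hdisj V hV _ (T.view_mem c hc.1) hne (congrArg Atom.rel h2 :)
      subst hVe
      rw [viewAtom, mapAtom_mapAtom, mapAtom_congr_iff] at h2
      exact ⟨ρ, fun _ _ => ⟨hρ, h2⟩⟩
    · exact ⟨id, fun h h' => absurd ⟨h, h'⟩ hc⟩
  choose ρ hρ using hex
  have hρ' : ∀ A ∈ T.body, (∀ C ∈ (T.view (T.idx A)).body, mapAtom (ρ (rep A)) C ∈ D) ∧
      ∀ v ∈ (T.view (T.idx A)).head.vars,
        ρ (rep A) v = θ (T.rename rep ι (rep A) (T.hom (T.idx A) v)) := by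
    intro A hA
    have h := hρ (rep A) (hrep A hA).1
      (((hrep _ (hrep A hA).1).2.2 A hA).2 (hrep A hA).2.1)
    rwa [idx_rep hrep hA] at h
  have hκ : ∀ x, ∃ c, ∀ A ∈ T.body, x ∈ A.vars → ∃ A₀ ∈ T.body, x ∈ A₀.vars ∧ rep A₀ = c := by
    intro x
    by_cases h : ∃ A ∈ T.body, x ∈ A.vars
    · obtain ⟨A, hA, hx⟩ := h
      exact ⟨rep A, fun _ _ _ => ⟨A, hA, hx, rfl⟩⟩
    · exact ⟨Q.head, fun A hA hx => absurd ⟨A, hA, hx⟩ h⟩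
  choose κ hκ using hκ
  let τ : ℕ → ℕ := fun x =>
    (T.loc x).elim (θ (T.rename rep ι (κ x) x)) fun t => ρ (κ x) t.2
  have hglob : ∀ A ∈ T.body, ∀ x ∈ A.vars, T.loc x = none →
      τ x = θ (T.rename rep ι (rep A) x) := by
    intro A hA x hx hloc
    obtain ⟨A₀, hA₀, hx₀, hc⟩ := hκ x A hA hx
    simp only [τ, hloc, Option.elim_none, ← hc]
    by_cases hne : rep A₀ = rep A
    · rw [hne]
    · have hsh : T.Shared rep x := Or.inr ⟨A₀, hA₀, A, hA, hx₀, hx, hne⟩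
      rw [rename, rename, if_pos ⟨hsh, A₀, hA₀, hx₀, rfl⟩, if_pos ⟨hsh, A, hA, hx, rfl⟩]
  have hτ : ∀ A ∈ T.body, mapAtom τ A ∈ D := by
    intro A hA
    suffices h : mapAtom τ A = mapAtom (ρ (rep A)) (T.preim A) by
      rw [h]
      exact (hρ' A hA).1 _ (T.preim_mem A hA)
    have hargs : A.args.map τ = (T.preim A).args.map (ρ (rep A)) := by
      rw [← List.forall₂_eq_eq_eq, List.forall₂_map_left_iff, List.forall₂_map_right_iff]
      refine ((List.forall₂_and_left (p := (· ∈ A.args)) _ _).2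
        ⟨fun _ h => h, T.preim_args A hA⟩).imp ?_
      rintro x v ⟨hx, ⟨hv, hloc, rfl⟩ | ⟨-, hloc⟩⟩
      · rw [hglob A hA _ (Atom.mem_vars.2 hx) hloc, (hρ' A hA).2 v hv]
      · obtain ⟨A₀, hA₀, hx₀, hc⟩ := hκ x A hA (Atom.mem_vars.2 hx)
        rw [rep_eq_of_loc hrep hA hA₀ (by simp [hloc]) (Atom.mem_vars.2 hx) hx₀, hc]
        simp [τ, hloc]
    simp [mapAtom, hargs, T.preim_rel A hA]
  refine ⟨fun x => τ (T.retr x), fun A hA => ?_, ?_⟩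
  · rw [← mapAtom_mapAtom]
    exact hτ _ (T.retr_mem A hA)
  · rw [query, mapAtom_mapAtom, mapAtom_congr_iff]
    intro x hx
    obtain ⟨A, hA, hxA⟩ := exists_mem_body (T := T) hs hx
    rw [T.retr_head x hx, hglob A hA x hxA (T.loc_head x hx), rename,
      if_pos ⟨Or.inl hx, A, hA, hxA, rfl⟩]

end

end ViewCover

/-- Every q-hierarchical CQ that has some 𝒱-rewriting also has a
q-hierarchical 𝒱-rewriting. -/
theorem statement9 (σ : Schema) (𝒱 : Finset CQ) (h𝒱 : isViewSet σ 𝒱)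
    (Q : CQ) (hQ : isCQ σ Q) (hH : isQHierarchical Q)
    (hfresh : ∀ V ∈ 𝒱, Q.head.rel ≠ V.head.rel)
    (hrw : ∃ Q', isRewriting σ 𝒱 Q Q') :
    ∃ Q', isRewriting σ 𝒱 Q Q' ∧ isQHierarchical Q' := by
  obtain ⟨Q₀, hQ₀⟩ := hrw
  obtain ⟨T⟩ := nonempty_viewCover h𝒱 hQ hQ₀
  have hs := hQ.2.2.2
  obtain ⟨hier, qhier⟩ := (isQHierarchical_iff hs).1 hH
  obtain ⟨rep, hrep⟩ := T.exists_rep hier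
  have := Atom.countable
  obtain ⟨ι, hι⟩ := exists_injective_nat (Option Atom × ℕ)
  refine ⟨T.query rep ι, ⟨⟨?_, ?_, hfresh, ViewCover.query_safe hrep hs⟩, fun D _ _ => ?_⟩,
    ViewCover.isQHierarchical_query hrep hier qhier hs hι⟩
  · obtain ⟨A, hA⟩ := hQ.1
    exact ⟨_, Finset.mem_image_of_mem _ (T.retr_mem A hA)⟩
  · refine ViewCover.forall_mem_query_body.2 fun A hA => ?_
    exact ⟨_, T.view_mem _ (hrep A hA).1, rfl, by simp [ViewCover.viewAtom, mapAtom]⟩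
  · exact (ViewCover.evalCQ_query_subset hrep hs h𝒱.2 D).antisymm
      (ViewCover.evalCQ_subset_evalCQ_query hrep hι D)
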